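/- Energy decomposition (Balog–Wooley type, weaker numerical form): for any finite A ⊂ ℝ \ {0} with |A| ≥ 2, there exist disjoint B, C with A = B ⊔ C such that max{E⁺(B), E^×(C)} ≤ K · |A|^{3 - 1/5} · (log |A|)^{c} for some absolute constants K, c > 0. -/

import Mathlib

open Finset
noncomputable section

def mulE (A B : Finset ℝ) : ℕ :=
  ((A ×ˢ B ×ˢ A ×ˢ B).filter fun q => q.1 * q.2.1 = q.2.2.1 * q.2.2.2).card

def addE (A B : Finset ℝ) : ℕ :=
  ((A ×ˢ B ×ˢ A ×ˢ B).filter fun q => q.1 + q.2.1 = q.2.2.1 + q.2.2.2).card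

def quot (A B : Finset ℝ) : Finset ℝ := (A ×ˢ B).image fun p => p.1 / p.2

def prodSet (A B : Finset ℝ) : Finset ℝ := (A ×ˢ B).image fun p => p.1 * p.2

def dil (l : ℝ) (A : Finset ℝ) : Finset ℝ := A.image fun a => l * a

/-- `x • R⁻¹ = {x / r : r ∈ R}` -/
def dilInv (x : ℝ) (R : Finset ℝ) : Finset ℝ := R.image fun r => x / r

/-- `x ∈ Sym^×_t(Q,R)` iff `|Q ∩ x R⁻¹| ≥ t`. -/
def symCond (t : ℝ) (Q R : Finset ℝ) (x : ℝ) : Prop :=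
  t ≤ ((Q ∩ dilInv x R).card : ℝ)

theorem card_filter_eq_eq_sum_mul {α β : Type*} (Z : Finset α) (W : Finset β) (F : α → ℝ)
    (G : β → ℝ) (T : Finset ℝ) (hT : ∀ z ∈ Z, F z ∈ T) :
    ((Z ×ˢ W).filter fun p => F p.1 = G p.2).card =
      ∑ s ∈ T, (Z.filter fun z => F z = s).card * (W.filter fun w => G w = s).card := by
  rw [card_eq_sum_card_fiberwise (f := fun p => F p.1) (t := T)]
  · refine sum_congr rfl fun s _ => ?_
    rw [← card_product]
    congr 1
    ext ⟨z, w⟩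
    simp only [mem_filter, mem_product]
    constructor
    · rintro ⟨⟨⟨hz, hw⟩, h⟩, h'⟩
      exact ⟨⟨hz, h'⟩, hw, h ▸ h'⟩
    · rintro ⟨⟨hz, h'⟩, hw, h⟩
      exact ⟨⟨⟨hz, hw⟩, h'.trans h.symm⟩, h'⟩
  · rintro ⟨z, w⟩ h
    simp only [coe_filter, mem_product, Set.mem_ofPred_eq] at h
    exact hT z h.1.1

/-- The number of representations of `s` as a sum of an element of `A` and an element of `B`. -/
def sumRep (A B : Finset ℝ) (s : ℝ) : ℕ := ((A ×ˢ B).filter fun p => p.1 + p.2 = s).card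

/-- The number of representations of `s` as a difference of two elements of `A`. -/
def diffRep (A : Finset ℝ) (s : ℝ) : ℕ := ((A ×ˢ A).filter fun p => p.1 - p.2 = s).card

/-- The number of representations of `s` as a product of an element of `A` and an element of `B`. -/
def mulRep (A B : Finset ℝ) (s : ℝ) : ℕ := ((A ×ˢ B).filter fun p => p.1 * p.2 = s).card

theorem addE_eq_sum_sumRep_sq (A B T : Finset ℝ) (hT : ∀ a ∈ A, ∀ b ∈ B, a + b ∈ T) :
    addE A B = ∑ s ∈ T, sumRep A B s ^ 2 := by
  have h := card_filter_eq_eq_sum_mul (A ×ˢ B) (A ×ˢ B) (fun p => p.1 + p.2)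
    (fun p => p.1 + p.2) T (fun p hp => hT _ (mem_product.1 hp).1 _ (mem_product.1 hp).2)
  simp only [sq, sumRep]
  rw [← h, addE]
  refine card_nbij' (fun q => ((q.1, q.2.1), (q.2.2.1, q.2.2.2)))
    (fun q => (q.1.1, q.1.2, q.2.1, q.2.2)) ?_ ?_ ?_ ?_ <;> intro q <;> simp <;> tauto

theorem mulE_eq_sum_mulRep_sq (A B T : Finset ℝ) (hT : ∀ a ∈ A, ∀ b ∈ B, a * b ∈ T) :
    mulE A B = ∑ s ∈ T, mulRep A B s ^ 2 := by
  have h := card_filter_eq_eq_sum_mul (A ×ˢ B) (A ×ˢ B) (fun p => p.1 * p.2)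
    (fun p => p.1 * p.2) T (fun p hp => hT _ (mem_product.1 hp).1 _ (mem_product.1 hp).2)
  simp only [sq, mulRep]
  rw [← h, mulE]
  refine card_nbij' (fun q => ((q.1, q.2.1), (q.2.2.1, q.2.2.2)))
    (fun q => (q.1.1, q.1.2, q.2.1, q.2.2)) ?_ ?_ ?_ ?_ <;> intro q <;> simp <;> tauto

theorem addE_eq_sum_diffRep_mul (A B T : Finset ℝ) (hT : ∀ a ∈ A, ∀ b ∈ A, a - b ∈ T) :
    addE A B = ∑ s ∈ T, diffRep A s * diffRep B s := by
  have h := card_filter_eq_eq_sum_mul (A ×ˢ A) (B ×ˢ B) (fun p => p.1 - p.2)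
    (fun p => p.1 - p.2) T (fun p hp => hT _ (mem_product.1 hp).1 _ (mem_product.1 hp).2)
  simp only [diffRep]
  rw [← h, addE]
  refine card_nbij' (fun q => ((q.1, q.2.2.1), (q.2.2.2, q.2.1)))
    (fun q => (q.1.1, q.2.2, q.1.2, q.2.1)) ?_ ?_ ?_ ?_ <;> rintro ⟨a, b⟩ <;>
    simp only [coe_filter, mem_product, Set.mem_ofPred_eq, implies_true]
  · rintro ⟨h1, h2⟩
    exact ⟨by tauto, by linarith⟩
  · rintro ⟨h1, h2⟩
    exact ⟨by tauto, by linarith⟩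

theorem sum_mul_le_of_sum_sq_le {ι : Type*} (T : Finset ι) (f g : ι → ℝ) {u v : ℝ}
    (hu : 0 ≤ u) (hv : 0 ≤ v) (hf : ∑ i ∈ T, f i ^ 2 ≤ u ^ 2) (hg : ∑ i ∈ T, g i ^ 2 ≤ v ^ 2) :
    ∑ i ∈ T, f i * g i ≤ u * v := by
  refine abs_le_of_sq_le_sq' ?_ (by positivity) |>.2
  calc (∑ i ∈ T, f i * g i) ^ 2 ≤ (∑ i ∈ T, f i ^ 2) * ∑ i ∈ T, g i ^ 2 :=
        sum_mul_sq_le_sq_mul_sq T f g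
    _ ≤ u ^ 2 * v ^ 2 := mul_le_mul hf hg (sum_nonneg fun _ _ => sq_nonneg _) (sq_nonneg _)
    _ = (u * v) ^ 2 := by ring

theorem addE_le_mul_of_addE_self_le (X Y : Finset ℝ) {u v : ℝ} (hu : 0 ≤ u) (hv : 0 ≤ v)
    (hX : (addE X X : ℝ) ≤ u ^ 2) (hY : (addE Y Y : ℝ) ≤ v ^ 2) : (addE X Y : ℝ) ≤ u * v := by
  set T := ((X ∪ Y) ×ˢ (X ∪ Y)).image fun p => p.1 - p.2
  have hT : ∀ a ∈ X ∪ Y, ∀ b ∈ X ∪ Y, a - b ∈ T := fun a ha b hb =>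
    mem_image.2 ⟨(a, b), mem_product.2 ⟨ha, hb⟩, rfl⟩
  have hTX : ∀ a ∈ X, ∀ b ∈ X, a - b ∈ T := fun a ha b hb =>
    hT a (mem_union_left _ ha) b (mem_union_left _ hb)
  have hTY : ∀ a ∈ Y, ∀ b ∈ Y, a - b ∈ T := fun a ha b hb =>
    hT a (mem_union_right _ ha) b (mem_union_right _ hb)
  rw [addE_eq_sum_diffRep_mul X X T hTX] at hX
  rw [addE_eq_sum_diffRep_mul Y Y T hTY] at hY
  rw [addE_eq_sum_diffRep_mul X Y T hTX]
  push_cast at hX hY ⊢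
  exact sum_mul_le_of_sum_sq_le T _ _ hu hv (by simpa only [sq] using hX)
    (by simpa only [sq] using hY)

theorem sumRep_union (X Y : Finset ℝ) (h : Disjoint X Y) (s : ℝ) :
    sumRep (X ∪ Y) (X ∪ Y) s = sumRep X X s + 2 * sumRep X Y s + sumRep Y Y s := by
  have hswap : sumRep Y X s = sumRep X Y s := by
    refine card_nbij' Prod.swap Prod.swap ?_ ?_ ?_ ?_ <;> rintro ⟨a, b⟩ <;>
      simp [add_comm] <;> tauto
  have h1 : sumRep (X ∪ Y) (X ∪ Y) s = sumRep X (X ∪ Y) s + sumRep Y (X ∪ Y) s := by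
    rw [sumRep, union_product, filter_union, card_union_of_disjoint]
    · rfl
    · exact disjoint_filter_filter (disjoint_product.2 (Or.inl h))
  have h2 : ∀ Z : Finset ℝ, sumRep Z (X ∪ Y) s = sumRep Z X s + sumRep Z Y s := by
    intro Z
    rw [sumRep, product_union, filter_union, card_union_of_disjoint]
    · rfl
    · exact disjoint_filter_filter (disjoint_product.2 (Or.inr h))
  rw [h1, h2, h2, hswap]
  ring

/-- The square root of `addE X X` is bounded like the square of a norm. -/
theorem addE_union_le (X Y : Finset ℝ) (h : Disjoint X Y) {k x y : ℝ} (hk : 0 ≤ k) (hx : 0 ≤ x)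
    (hy : 0 ≤ y) (hX : (addE X X : ℝ) ≤ (k * x ^ 2) ^ 2) (hY : (addE Y Y : ℝ) ≤ (k * y ^ 2) ^ 2) :
    (addE (X ∪ Y) (X ∪ Y) : ℝ) ≤ (k * (x + y) ^ 2) ^ 2 := by
  have hXY : (addE X Y : ℝ) ≤ (k * (x * y)) ^ 2 :=
    (addE_le_mul_of_addE_self_le X Y (by positivity) (by positivity) hX hY).trans_eq (by ring)
  set T := ((X ∪ Y) ×ˢ (X ∪ Y)).image fun p => p.1 + p.2
  have hT : ∀ a ∈ X ∪ Y, ∀ b ∈ X ∪ Y, a + b ∈ T := fun a ha b hb =>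
    mem_image.2 ⟨(a, b), mem_product.2 ⟨ha, hb⟩, rfl⟩
  rw [addE_eq_sum_sumRep_sq X X T fun a ha b hb =>
    hT a (mem_union_left _ ha) b (mem_union_left _ hb)] at hX
  rw [addE_eq_sum_sumRep_sq Y Y T fun a ha b hb =>
    hT a (mem_union_right _ ha) b (mem_union_right _ hb)] at hY
  rw [addE_eq_sum_sumRep_sq X Y T fun a ha b hb =>
    hT a (mem_union_left _ ha) b (mem_union_right _ hb)] at hXY
  rw [addE_eq_sum_sumRep_sq _ _ T hT]
  simp only [sumRep_union X Y h]
  push_cast at hX hY hXY ⊢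
  have e1 := sum_mul_le_of_sum_sq_le T _ _ (by positivity) (by positivity) hX hXY
  have e2 := sum_mul_le_of_sum_sq_le T _ _ (by positivity) (by positivity) hX hY
  have e3 := sum_mul_le_of_sum_sq_le T _ _ (by positivity) (by positivity) hXY hY
  have key : ∑ s ∈ T, ((sumRep X X s : ℝ) + 2 * sumRep X Y s + sumRep Y Y s) ^ 2 =
      ∑ s ∈ T, (sumRep X X s : ℝ) ^ 2 + 4 * ∑ s ∈ T, (sumRep X Y s : ℝ) ^ 2 +
      ∑ s ∈ T, (sumRep Y Y s : ℝ) ^ 2 + 4 * ∑ s ∈ T, (sumRep X X s : ℝ) * sumRep X Y s +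
      2 * ∑ s ∈ T, (sumRep X X s : ℝ) * sumRep Y Y s +
      4 * ∑ s ∈ T, (sumRep X Y s : ℝ) * sumRep Y Y s := by
    simp only [mul_sum, ← sum_add_distrib]
    exact sum_congr rfl fun s _ => by ring
  rw [key]
  have : (k * (x + y) ^ 2) ^ 2 = (k * x ^ 2) ^ 2 + 4 * (k * (x * y)) ^ 2 + (k * y ^ 2) ^ 2 +
      4 * (k * x ^ 2 * (k * (x * y))) + 2 * (k * x ^ 2 * (k * y ^ 2)) +
      4 * (k * (x * y) * (k * y ^ 2)) := by ring
  linarith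

/-- A finite set on which two block labels increase meets few blocks; the surplus is counted by
pairs of points in a common block. -/
theorem card_le_add_card_pairs (T : Finset ℝ) (f g : ℝ → ℕ) (F G : ℕ) (hf : MonotoneOn f T)
    (hg : MonotoneOn g T) (hF : ∀ u ∈ T, f u ≤ F) (hG : ∀ u ∈ T, g u ≤ G) :
    T.card ≤ F + G + 1 +
      (T.offDiag.filter fun p => f p.1 = f p.2 ∧ g p.1 = g p.2).card := by
  have hmap : ∀ u ∈ T, f u + g u ∈ range (F + G + 1) := fun u hu =>
    mem_range.2 (by have := hF u hu; have := hG u hu; omega)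
  have hsub : (T.offDiag.filter fun p => f p.1 + g p.1 = f p.2 + g p.2) ⊆
      T.offDiag.filter fun p => f p.1 = f p.2 ∧ g p.1 = g p.2 := by
    rintro ⟨a, b⟩ h
    simp only [mem_filter, mem_offDiag] at h ⊢
    obtain ⟨⟨ha, hb, hab⟩, he⟩ := h
    refine ⟨⟨ha, hb, hab⟩, ?_⟩
    rcases le_total a b with hle | hle
    · have := hf ha hb hle; have := hg ha hb hle; omega
    · have := hf hb ha hle; have := hg hb ha hle; omega
  refine le_trans ?_ (Nat.add_le_add_left (card_le_card hsub) _)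
  rw [card_eq_sum_card_fiberwise (f := fun u => f u + g u) hmap,
    card_eq_sum_card_fiberwise (s := T.offDiag.filter _) (f := fun p => f p.1 + g p.1)
      (t := range (F + G + 1)) (fun p hp => by
        simp only [coe_filter, mem_offDiag, Set.mem_ofPred_eq] at hp
        exact hmap _ hp.1.1)]
  calc ∑ j ∈ range (F + G + 1), (T.filter fun u => f u + g u = j).card
      ≤ ∑ j ∈ range (F + G + 1), (1 + (T.filter fun u => f u + g u = j).offDiag.card) := by
        refine sum_le_sum fun j _ => ?_
        rw [offDiag_card]
        generalize (T.filter fun u => f u + g u = j).card = n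
        rcases n with _ | _ | n
        · simp
        · simp
        · have : (n + 1 + 1) * (n + 1 + 1) - (n + 1 + 1) = (n + 1 + 1) * (n + 1) := by
            rw [← Nat.mul_sub_one]; rfl
          rw [this]; nlinarith
    _ = F + G + 1 + ∑ j ∈ range (F + G + 1), (T.filter fun u => f u + g u = j).offDiag.card := by
        rw [sum_add_distrib]; simp
    _ ≤ _ := by
        refine Nat.add_le_add_left (sum_le_sum fun j _ => card_le_card ?_) _
        rintro ⟨a, b⟩ h
        simp only [mem_filter, mem_offDiag] at h ⊢
        obtain ⟨⟨ha, ha'⟩, ⟨hb, hb'⟩, hab⟩ := h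
        exact ⟨⟨⟨ha, hb, hab⟩, by omega⟩, ha'⟩

/-- The label of the block containing `u` when `U` is cut into consecutive blocks of size `w`. -/
def blockIdx (U : Finset ℝ) (w : ℕ) (u : ℝ) : ℕ := (U.filter fun x => x < u).card / w

theorem blockIdx_mono (U : Finset ℝ) (w : ℕ) : Monotone (blockIdx U w) := fun a b hab =>
  Nat.div_le_div_right (card_le_card fun x hx => by
    simp only [mem_filter] at hx ⊢
    exact ⟨hx.1, hx.2.trans_le hab⟩)

theorem blockIdx_le (U : Finset ℝ) (w : ℕ) (u : ℝ) : blockIdx U w u ≤ U.card / w :=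
  Nat.div_le_div_right (card_filter_le _ _)

theorem card_block_le (U : Finset ℝ) {w : ℕ} (hw : 0 < w) (j : ℕ) :
    (U.filter fun u => blockIdx U w u = j).card ≤ w := by
  have hinj : Set.InjOn (fun u => (U.filter fun x => x < u).card)
      (U.filter fun u => blockIdx U w u = j : Finset ℝ) := by
    have key : ∀ a ∈ U, ∀ b, a < b →
        (U.filter fun x => x < a).card < (U.filter fun x => x < b).card := by
      intro a ha b hab
      refine card_lt_card ⟨fun x hx => ?_, fun h => ?_⟩
      · simp only [mem_filter] at hx ⊢
        exact ⟨hx.1, hx.2.trans hab⟩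
      · have : a ∈ U.filter fun x => x < a := h (mem_filter.2 ⟨ha, hab⟩)
        exact lt_irrefl _ (mem_filter.1 this).2
    intro a ha b hb hab
    simp only [coe_filter, Set.mem_ofPred_eq] at ha hb
    rcases lt_trichotomy a b with h | h | h
    · exact absurd hab (key a ha.1 b h).ne
    · exact h
    · exact absurd hab (key b hb.1 a h).ne'
  rw [← card_image_of_injOn hinj]
  calc _ ≤ (Ico (j * w) (j * w + w)).card := by
        refine card_le_card fun m hm => ?_
        obtain ⟨u, hu, rfl⟩ := mem_image.1 hm
        have h := (mem_filter.1 hu).2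
        rw [blockIdx, Nat.div_eq_iff hw] at h
        simp only [mem_Ico]
        omega
    _ = w := by simp

/-- A Szemerédi–Trotter type bound for the incidences between a grid and a family of lines. -/
theorem card_incidences_le (U V : Finset ℝ) (L : Finset (ℝ × ℝ)) (hL : ∀ l ∈ L, l.1 ≠ 0)
    {w z : ℕ} (hw : 0 < w) (hz : 0 < z) :
    ((L ×ˢ U).filter fun p => p.1.1 * p.2 + p.1.2 ∈ V).card ≤
      L.card * (U.card / w + V.card / z + 1) + U.card * V.card * (w * z) := by
  set pairs : ℝ × ℝ → Finset (ℝ × ℝ) := fun l =>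
    (U.filter fun u => l.1 * u + l.2 ∈ V).offDiag.filter fun p =>
      blockIdx U w p.1 = blockIdx U w p.2 ∧
        blockIdx V z (l.1 * p.1 + l.2) = blockIdx V z (l.1 * p.2 + l.2) with hpairs
  have hline : ∀ l ∈ L, (U.filter fun u => l.1 * u + l.2 ∈ V).card ≤
      U.card / w + V.card / z + 1 + (pairs l).card := by
    intro l hl
    rcases lt_or_gt_of_ne (hL l hl) with hneg | hpos
    · have h := card_le_add_card_pairs (U.filter fun u => l.1 * u + l.2 ∈ V) (blockIdx U w)
        (fun u => V.card / z - blockIdx V z (l.1 * u + l.2)) (U.card / w) (V.card / z)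
        ((blockIdx_mono U w).monotoneOn _)
        (fun a _ b _ hab => Nat.sub_le_sub_left (blockIdx_mono V z
          (by nlinarith [mul_le_mul_of_nonpos_left hab hneg.le])) _)
        (fun u _ => blockIdx_le U w u) (fun u _ => Nat.sub_le _ _)
      refine h.trans (Nat.add_le_add_left (card_le_card fun p hp => ?_) _)
      simp only [hpairs, mem_filter] at hp ⊢
      refine ⟨hp.1, hp.2.1, ?_⟩
      have h1 := blockIdx_le V z (l.1 * p.1 + l.2)
      have h2 := blockIdx_le V z (l.1 * p.2 + l.2)
      have h3 := hp.2.2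
      omega
    · exact card_le_add_card_pairs (U.filter fun u => l.1 * u + l.2 ∈ V) (blockIdx U w)
        (fun u => blockIdx V z (l.1 * u + l.2)) (U.card / w) (V.card / z)
        ((blockIdx_mono U w).monotoneOn _)
        (fun a _ b _ hab => blockIdx_mono V z
          (by nlinarith [mul_le_mul_of_nonneg_left hab hpos.le]))
        (fun u _ => blockIdx_le U w u) (fun u _ => blockIdx_le V z _)
  have hcount : ((L ×ˢ U).filter fun p => p.1.1 * p.2 + p.1.2 ∈ V).card =
      ∑ l ∈ L, (U.filter fun u => l.1 * u + l.2 ∈ V).card := by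
    simp only [card_filter]
    rw [sum_product]
  have hpairs_le : ∑ l ∈ L, (pairs l).card ≤ U.card * V.card * (w * z) := by
    calc ∑ l ∈ L, (pairs l).card = (L.sigma pairs).card := (card_sigma _ _).symm
      _ ≤ ((U ×ˢ V).sigma fun p =>
            (U.filter fun u => blockIdx U w u = blockIdx U w p.1) ×ˢ
              (V.filter fun v => blockIdx V z v = blockIdx V z p.2)).card := by
          refine card_le_card_of_injOn (fun q => ⟨(q.2.1, q.1.1 * q.2.1 + q.1.2),
            (q.2.2, q.1.1 * q.2.2 + q.1.2)⟩) ?_ ?_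
          · rintro ⟨l, p⟩ h
            simp only [hpairs, coe_sigma, Set.mem_sigma_iff, mem_coe, mem_filter, mem_offDiag,
              mem_product] at h ⊢
            obtain ⟨-, ⟨⟨h1, h2⟩, ⟨h3, h4⟩, -⟩, h5, h6⟩ := h
            exact ⟨⟨h1, h2⟩, ⟨h3, h5.symm⟩, h4, h6.symm⟩
          · rintro ⟨⟨m, c⟩, ⟨a, b⟩⟩ h ⟨⟨m', c'⟩, ⟨a', b'⟩⟩ h' heq
            simp only [hpairs, coe_sigma, Set.mem_sigma_iff, mem_coe, mem_filter, mem_offDiag]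
              at h h'
            simp only [Sigma.mk.injEq, Prod.mk.injEq, heq_eq_eq] at heq
            obtain ⟨⟨rfl, h2⟩, rfl, h4⟩ := heq
            have hne : a - b ≠ 0 := sub_ne_zero.2 h.2.1.2.2
            have hm : m = m' := mul_right_cancel₀ hne (by linarith)
            subst hm
            have hc : c = c' := by linarith
            subst hc
            rfl
      _ = ∑ p ∈ U ×ˢ V, (U.filter fun u => blockIdx U w u = blockIdx U w p.1).card *
            (V.filter fun v => blockIdx V z v = blockIdx V z p.2).card := by
          rw [card_sigma]; simp only [card_product]
      _ ≤ ∑ p ∈ U ×ˢ V, w * z :=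
          sum_le_sum fun p _ => Nat.mul_le_mul (card_block_le U hw _) (card_block_le V hz _)
      _ = U.card * V.card * (w * z) := by simp
  rw [hcount]
  calc _ ≤ ∑ l ∈ L, (U.card / w + V.card / z + 1 + (pairs l).card) := sum_le_sum hline
    _ = L.card * (U.card / w + V.card / z + 1) + ∑ l ∈ L, (pairs l).card := by
        rw [sum_add_distrib]; simp
    _ ≤ _ := Nat.add_le_add_left hpairs_le _

/-- If every `a ∈ A` has at least `t` representations `a = p / q` with `p ∈ P` and `q ∈ X`, then few
real numbers have at least `τ` representations as a sum of two elements of `A`. -/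
theorem card_mul_pow_le_of_le_sumRep (X P A S : Finset ℝ) (hX : (0 : ℝ) ∉ X) (hP : (0 : ℝ) ∉ P)
    {t τ : ℕ} (ht : 0 < t) (hτ : 0 < τ) (hA : ∀ a ∈ A, t ≤ (X.filter fun q => a * q ∈ P).card)
    (hAX : A.card ≤ X.card) (htP : t ≤ P.card) (hPτ : 8 * P.card ≤ τ * t)
    (hS : ∀ s ∈ S, τ ≤ sumRep A A s) :
    (S.card : ℝ) * ((τ : ℝ) * t) ^ 3 ≤
      512 * (X.card : ℝ) ^ 2 * (A.card : ℝ) ^ 2 * (P.card : ℝ) ^ 2 := by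
  have hrep : ∀ s, sumRep A A s = (A.filter fun b => s - b ∈ A).card := by
    intro s
    refine card_nbij' (fun p => p.2) (fun b => (s - b, b)) ?_ ?_ ?_ ?_
    · rintro ⟨a, b⟩ h
      simp only [coe_filter, mem_product, Set.mem_ofPred_eq] at h ⊢
      rw [← h.2, add_sub_cancel_right]
      exact ⟨h.1.2, h.1.1⟩
    · intro b h
      simp only [coe_filter, mem_product, Set.mem_ofPred_eq] at h ⊢
      exact ⟨⟨h.2, h.1⟩, by ring⟩
    · rintro ⟨a, b⟩ h
      simp only [coe_filter, mem_product, Set.mem_ofPred_eq] at h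
      exact Prod.ext (by simp only; linarith [h.2]) rfl
    · intro b _
      rfl
  rcases S.eq_empty_or_nonempty with rfl | ⟨s₀, hs₀⟩
  · simp only [card_empty, CharP.cast_eq_zero, zero_mul]
    positivity
  have hτA : τ ≤ A.card := (hS s₀ hs₀).trans ((hrep s₀).trans_le (card_filter_le _ _))
  set L := (P.image fun p => -p) ×ˢ S with hL
  set U := X.image fun x => x⁻¹ with hU
  have hLcard : L.card = P.card * S.card := by
    rw [hL, card_product, card_image_of_injective _ neg_injective]
  have hUcard : U.card = X.card := card_image_of_injective _ inv_injective
  have hL0 : ∀ l ∈ L, l.1 ≠ 0 := by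
    rintro ⟨m, s⟩ hl
    rw [hL, mem_product, mem_image] at hl
    obtain ⟨⟨p, hp, hpm⟩, -⟩ := hl
    intro h0
    have : p = 0 := by simp only at hpm h0; linarith
    exact hP (this ▸ hp)
  have hlower : τ * t * S.card ≤
      ((L ×ˢ U).filter fun p => p.1.1 * p.2 + p.1.2 ∈ A).card := by
    calc τ * t * S.card = ∑ s ∈ S, τ * t := by simp [mul_comm]
      _ ≤ ∑ s ∈ S, (A.filter fun b => s - b ∈ A).card * t :=
          sum_le_sum fun s hs => Nat.mul_le_mul_right _ ((hS s hs).trans_eq (hrep s))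
      _ = ∑ s ∈ S, ∑ b ∈ A.filter (fun b => s - b ∈ A), t := by simp
      _ ≤ ∑ s ∈ S, ∑ b ∈ A.filter (fun b => s - b ∈ A),
            (X.filter fun q => (s - b) * q ∈ P).card :=
          sum_le_sum fun s _ => sum_le_sum fun b hb => hA _ (mem_filter.1 hb).2
      _ = (S.sigma fun s => (A.filter fun b => s - b ∈ A).sigma fun b =>
            X.filter fun q => (s - b) * q ∈ P).card := by simp only [card_sigma]
      _ ≤ _ := by
          refine card_le_card_of_injOn
            (fun x => ((-((x.1 - x.2.1) * x.2.2), x.1), x.2.2⁻¹)) ?_ ?_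
          · rintro ⟨s, b, q⟩ h
            simp only [coe_sigma, Set.mem_sigma_iff, mem_coe, mem_filter] at h
            obtain ⟨hs, ⟨hb, -⟩, hq, hp⟩ := h
            have hq0 : q ≠ 0 := fun h => hX (h ▸ hq)
            simp only [coe_filter, Set.mem_ofPred_eq, hL, hU, mem_product, mem_image]
            refine ⟨⟨⟨⟨_, hp, rfl⟩, hs⟩, ⟨q, hq, rfl⟩⟩, ?_⟩
            have : -((s - b) * q) * q⁻¹ + s = b := by field_simp; ring
            rw [this]; exact hb
          · rintro ⟨s, b, q⟩ h ⟨s', b', q'⟩ h' heq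
            simp only [coe_sigma, Set.mem_sigma_iff, mem_coe, mem_filter] at h
            have hq0 : q ≠ 0 := fun h0 => hX (h0 ▸ h.2.2.1)
            simp only [Prod.mk.injEq, inv_inj] at heq
            obtain ⟨⟨h1, rfl⟩, rfl⟩ := heq
            have h2 : (s - b) = s - b' := mul_right_cancel₀ hq0 (neg_injective h1)
            have h3 : b = b' := by linarith
            subst h3
            rfl
  have hApos : (0 : ℝ) < A.card := by exact_mod_cast hτ.trans_le hτA
  have hPpos : (0 : ℝ) < P.card := by exact_mod_cast ht.trans_le htP
  have htR : (0 : ℝ) < t := by exact_mod_cast ht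
  have hτR : (0 : ℝ) < τ := by exact_mod_cast hτ
  have hXpos : (0 : ℝ) < X.card := hApos.trans_le (by exact_mod_cast hAX)
  obtain ⟨y, hy⟩ : ∃ y : ℝ, y = τ * t / (8 * P.card) := ⟨_, rfl⟩
  have hyP : y * (8 * P.card) = τ * t := by rw [hy]; field_simp
  have hy1 : 1 ≤ y := by
    rw [hy, le_div_iff₀ (by positivity), one_mul]
    exact_mod_cast hPτ
  have hy0 : 0 < y := by linarith
  have hyA : y ≤ A.card := by
    have h1 : (t : ℝ) ≤ P.card := by exact_mod_cast htP
    have h2 : (τ : ℝ) ≤ A.card := by exact_mod_cast hτA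
    rw [hy, div_le_iff₀ (by positivity)]
    nlinarith [mul_le_mul h2 h1 htR.le hApos.le, mul_pos hApos hPpos]
  have hblock : ∀ m : ℝ, 0 < m → y ≤ m →
      0 < ⌈m / y⌉₊ ∧ m / ⌈m / y⌉₊ ≤ y ∧ (⌈m / y⌉₊ : ℝ) ≤ 2 * (m / y) := by
    intro m hm hym
    have h1 : 1 ≤ m / y := by rw [le_div_iff₀ hy0]; linarith
    have hpos : 0 < ⌈m / y⌉₊ := Nat.ceil_pos.2 (by linarith)
    refine ⟨hpos, ?_, ?_⟩
    · have := Nat.le_ceil (m / y)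
      rw [div_le_iff₀ hy0] at this
      rw [div_le_iff₀ (by exact_mod_cast hpos)]
      linarith
    · have := Nat.ceil_lt_add_one (show 0 ≤ m / y by positivity)
      linarith
  obtain ⟨hw, hw1, hw2⟩ := hblock X.card hXpos (hyA.trans (by exact_mod_cast hAX))
  obtain ⟨hz, hz1, hz2⟩ := hblock A.card hApos hyA
  have hinc := hlower.trans (card_incidences_le U A L hL0 hw hz)
  rw [hLcard, hUcard] at hinc
  generalize ⌈(X.card : ℝ) / y⌉₊ = w at hw hw1 hw2 hinc
  generalize ⌈(A.card : ℝ) / y⌉₊ = z at hz hz1 hz2 hinc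
  have hincR : (τ : ℝ) * t * S.card ≤
      P.card * S.card * ((X.card : ℝ) / w + (A.card : ℝ) / z + 1) +
        X.card * A.card * (w * z) := by
    refine (show (τ : ℝ) * t * S.card ≤ P.card * S.card *
      ((X.card / w : ℕ) + (A.card / z : ℕ) + 1) + X.card * A.card * (w * z) by
        exact_mod_cast hinc).trans ?_
    have h1 : ((X.card / w : ℕ) : ℝ) ≤ (X.card : ℝ) / w := Nat.cast_div_le
    have h2 : ((A.card / z : ℕ) : ℝ) ≤ (A.card : ℝ) / z := Nat.cast_div_le
    gcongr
  have h1 : (P.card : ℝ) * S.card * ((X.card : ℝ) / w + (A.card : ℝ) / z + 1) ≤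
      P.card * S.card * (4 * y) := by
    gcongr
    linarith
  have h2 : (X.card : ℝ) * A.card * (w * z) ≤
      X.card * A.card * (2 * (X.card / y) * (2 * (A.card / y))) := by
    gcongr
  have h3 : (P.card : ℝ) * S.card * (4 * y) = τ * t * S.card / 2 := by
    rw [← hyP]; ring
  have h4 : (τ : ℝ) * t * S.card / 2 ≤
      X.card * A.card * (2 * (X.card / y) * (2 * (A.card / y))) := by linarith
  have h5 : (X.card : ℝ) * A.card * (2 * (X.card / y) * (2 * (A.card / y))) * y ^ 2 =
      4 * X.card ^ 2 * A.card ^ 2 := by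
    field_simp
    ring
  have h6 : (τ : ℝ) * t * S.card / 2 * y ^ 2 ≤ 4 * X.card ^ 2 * A.card ^ 2 := by
    rw [← h5]; gcongr
  calc (S.card : ℝ) * ((τ : ℝ) * t) ^ 3
      = 128 * (P.card : ℝ) ^ 2 * ((τ : ℝ) * t * S.card / 2 * y ^ 2) := by rw [← hyP]; ring
    _ ≤ 128 * (P.card : ℝ) ^ 2 * (4 * X.card ^ 2 * A.card ^ 2) := by gcongr
    _ = _ := by ring

theorem sq_le_mul_add_sum_ite (k r N : ℕ) (hr : r ≤ N) :
    (r : ℝ) ^ 2 ≤ k * r + ∑ τ ∈ Ioc k N, if τ ≤ r then 2 * (τ : ℝ) else 0 := by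
  rw [← sum_filter]
  have : (Ioc k N).filter (fun τ => τ ≤ r) = Ioc k r := by
    ext τ; simp only [mem_filter, mem_Ioc]; omega
  rw [this]
  clear hr this
  induction r with
  | zero => simp
  | succ r ih =>
    rcases lt_or_ge r k with h | h
    · rw [Ioc_eq_empty (by omega), sum_empty, add_zero]
      have : (r : ℝ) + 1 ≤ k := by exact_mod_cast h
      push_cast
      nlinarith
    · rw [sum_Ioc_succ_top h]
      push_cast
      nlinarith [Nat.cast_nonneg (α := ℝ) k]

theorem addE_mul_sq_le (X P A : Finset ℝ) (hX : (0 : ℝ) ∉ X) (hP : (0 : ℝ) ∉ P)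
    {t : ℕ} (ht : 0 < t) (hA : ∀ a ∈ A, t ≤ (X.filter fun q => a * q ∈ P).card)
    (hAX : A ⊆ X) (hA0 : A.Nonempty) :
    (addE A A : ℝ) * (t : ℝ) ^ 2 ≤
      265 * (X.card * √X.card) * (A.card : ℝ) ^ 2 * P.card := by
  obtain ⟨a₀, ha₀⟩ := hA0
  have ha₀0 : a₀ ≠ 0 := fun h => hX (h ▸ hAX ha₀)
  have htP : t ≤ P.card := (hA a₀ ha₀).trans
    (card_le_card_of_injOn (fun q => a₀ * q) (fun q hq => (mem_filter.1 hq).2)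
      (fun q _ q' _ h => mul_left_cancel₀ ha₀0 h))
  have htX : t ≤ X.card := (hA a₀ ha₀).trans (card_filter_le _ _)
  have htR : (0 : ℝ) < t := by exact_mod_cast ht
  have htPR : (t : ℝ) ≤ P.card := by exact_mod_cast htP
  have htXR : (t : ℝ) ≤ X.card := by exact_mod_cast htX
  have hPpos : (0 : ℝ) < P.card := htR.trans_le htPR
  have hXpos : (0 : ℝ) < X.card := htR.trans_le htXR
  have hX1 : (1 : ℝ) ≤ X.card := by exact_mod_cast ht.trans_le htX
  obtain ⟨R, hR⟩ : ∃ R : ℝ, R = √X.card := ⟨_, rfl⟩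
  have hR2 : R ^ 2 = X.card := by rw [hR]; exact Real.sq_sqrt hXpos.le
  have hR1 : 1 ≤ R := by rw [hR]; exact Real.one_le_sqrt.2 hX1
  rw [← hR]
  obtain ⟨W, hW⟩ : ∃ W : ℝ, W = X.card * R * P.card / t ^ 2 := ⟨_, rfl⟩
  have hWt : W * t ^ 2 = X.card * R * P.card := by rw [hW]; field_simp
  have hXP : (t : ℝ) ^ 2 ≤ X.card * P.card := by nlinarith
  have hW1 : 1 ≤ W := by
    rw [hW, le_div_iff₀ (by positivity)]
    nlinarith [mul_pos hXpos hPpos]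
  set k := ⌈8 * W⌉₊ with hk
  have hk8 : 8 * W ≤ k := Nat.le_ceil _
  have hk9 : (k : ℝ) ≤ 9 * W := by
    have := Nat.ceil_lt_add_one (show 0 ≤ 8 * W by positivity)
    linarith
  set T := (A ×ˢ A).image fun p => p.1 + p.2 with hT
  have hTmem : ∀ a ∈ A, ∀ b ∈ A, a + b ∈ T := fun a ha b hb =>
    mem_image.2 ⟨(a, b), mem_product.2 ⟨ha, hb⟩, rfl⟩
  have hrepN : ∀ s, sumRep A A s ≤ A.card := fun s =>
    card_le_card_of_injOn Prod.fst (fun p hp => (mem_product.1 (mem_filter.1 hp).1).1) (by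
      rintro ⟨a, b⟩ h ⟨a', b'⟩ h' heq
      simp only [coe_filter, Set.mem_ofPred_eq] at h h' heq
      exact Prod.ext heq (by simp only; linarith [h.2, h'.2]))
  have hsum : ∑ s ∈ T, (sumRep A A s : ℝ) = (A.card : ℝ) ^ 2 := by
    have : (A ×ˢ A).card = ∑ s ∈ T, sumRep A A s :=
      card_eq_sum_card_fiberwise (fun p hp => mem_image_of_mem _ hp)
    rw [card_product] at this
    rw [sq]
    exact_mod_cast this.symm
  have hlevel : ∀ τ ∈ Ioc k A.card,
      2 * (τ : ℝ) * (T.filter fun s => τ ≤ sumRep A A s).card ≤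
        1024 * (X.card : ℝ) ^ 2 * (A.card : ℝ) ^ 2 * (P.card : ℝ) ^ 2 / t ^ 3 *
          ((τ : ℝ) ^ 2)⁻¹ := by
    intro τ hτ
    have hkτ : k < τ := (mem_Ioc.1 hτ).1
    have hkτR : (k : ℝ) < τ := by exact_mod_cast hkτ
    have hτR : (0 : ℝ) < τ := by linarith
    have hPτ : (8 * P.card : ℝ) ≤ τ * t := by
      have h1 : (P.card : ℝ) * t ≤ W * t ^ 2 := by
        rw [hWt]
        calc (P.card : ℝ) * t ≤ P.card * X.card := by gcongr
          _ ≤ P.card * X.card * R := le_mul_of_one_le_right (by positivity) hR1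
          _ = _ := by ring
      have h2 : (P.card : ℝ) ≤ W * t := le_of_mul_le_mul_right (by linarith) htR
      nlinarith
    have h := card_mul_pow_le_of_le_sumRep X P A (T.filter fun s => τ ≤ sumRep A A s) hX hP ht
      (by omega) hA (card_le_card hAX) htP (by exact_mod_cast hPτ) (fun s hs => (mem_filter.1 hs).2)
    rw [← div_eq_mul_inv, div_div, le_div_iff₀ (by positivity)]
    calc _ = 2 * (((T.filter fun s => τ ≤ sumRep A A s).card : ℝ) * ((τ : ℝ) * t) ^ 3) := by ring
      _ ≤ 2 * (512 * (X.card : ℝ) ^ 2 * (A.card : ℝ) ^ 2 * (P.card : ℝ) ^ 2) := by gcongr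
      _ = _ := by ring
  have hinv : ∑ τ ∈ Ioc k A.card, ((τ : ℝ) ^ 2)⁻¹ ≤ 2 / (k + 1) := by
    have : Ioc k A.card = Ioo k (A.card + 1) := by ext; simp only [mem_Ioc, mem_Ioo]; omega
    rw [this]
    exact sum_Ioo_inv_sq_le k (A.card + 1)
  have hE : (addE A A : ℝ) ≤ k * (A.card : ℝ) ^ 2 +
      1024 * (X.card : ℝ) ^ 2 * (A.card : ℝ) ^ 2 * (P.card : ℝ) ^ 2 / t ^ 3 * (2 / (k + 1)) := by
    rw [addE_eq_sum_sumRep_sq A A T hTmem]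
    push_cast
    calc ∑ s ∈ T, (sumRep A A s : ℝ) ^ 2
        ≤ ∑ s ∈ T, (k * (sumRep A A s : ℝ) +
            ∑ τ ∈ Ioc k A.card, if τ ≤ sumRep A A s then 2 * (τ : ℝ) else 0) :=
          sum_le_sum fun s _ => sq_le_mul_add_sum_ite k _ _ (hrepN s)
      _ = k * (A.card : ℝ) ^ 2 + ∑ τ ∈ Ioc k A.card,
            2 * (τ : ℝ) * (T.filter fun s => τ ≤ sumRep A A s).card := by
          rw [sum_add_distrib, ← mul_sum, hsum, sum_comm]
          congr 1
          refine sum_congr rfl fun τ _ => ?_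
          rw [← sum_filter, sum_const, nsmul_eq_mul, mul_comm]
      _ ≤ k * (A.card : ℝ) ^ 2 + ∑ τ ∈ Ioc k A.card,
            1024 * (X.card : ℝ) ^ 2 * (A.card : ℝ) ^ 2 * (P.card : ℝ) ^ 2 / t ^ 3 *
              ((τ : ℝ) ^ 2)⁻¹ := by
          exact add_le_add_right (sum_le_sum hlevel) _
      _ ≤ _ := by
          rw [← mul_sum]
          gcongr
  have htail : 1024 * (X.card : ℝ) ^ 2 * (A.card : ℝ) ^ 2 * (P.card : ℝ) ^ 2 / t ^ 3 *
      (2 / (k + 1)) ≤ 256 * W * (A.card : ℝ) ^ 2 := by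
    calc _ ≤ 1024 * (X.card : ℝ) ^ 2 * (A.card : ℝ) ^ 2 * (P.card : ℝ) ^ 2 / t ^ 3 *
          (2 / (8 * W)) := by
          gcongr
          linarith
      _ ≤ 256 * W * (A.card : ℝ) ^ 2 := by
          have hXt : (t : ℝ) ≤ R ^ 2 := by rw [hR2]; exact htXR
          rw [hW, ← hR2]
          rw [div_mul_div_comm, div_le_iff₀ (by positivity)]
          field_simp
          nlinarith
  calc (addE A A : ℝ) * (t : ℝ) ^ 2 ≤ (265 * W * (A.card : ℝ) ^ 2) * (t : ℝ) ^ 2 := by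
        gcongr
        nlinarith [sq_nonneg (A.card : ℝ)]
    _ = 265 * (A.card : ℝ) ^ 2 * (W * t ^ 2) := by ring
    _ = _ := by rw [hWt]; ring

/-- A pigeonhole principle for level sets, with a harmonic loss. -/
theorem exists_level_set_ge {ι : Type*} (Z : Finset ι) (f : ι → ℕ) (N : ℕ)
    (hf : ∀ x ∈ Z, f x ≤ N) (g G : ℕ → ℝ)
    (hG : ∀ m, G m ≤ ∑ t ∈ Icc 1 m, g t / t) (hpos : 0 < ∑ x ∈ Z, G (f x)) :
    ∃ t, 1 ≤ t ∧
      ∑ x ∈ Z, G (f x) ≤ (harmonic N : ℝ) * (g t * (Z.filter fun x => t ≤ f x).card) := by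
  by_contra! hcon
  have hS : ∑ x ∈ Z, G (f x) ≤
      ∑ t ∈ Icc 1 N, g t * (Z.filter fun x => t ≤ f x).card / (t : ℝ) := by
    calc ∑ x ∈ Z, G (f x) ≤ ∑ x ∈ Z, ∑ t ∈ Icc 1 N, if t ≤ f x then g t / t else 0 := by
          refine sum_le_sum fun x hx => (hG _).trans_eq ?_
          rw [← sum_filter]
          congr 1
          ext t
          have := hf x hx
          simp only [mem_Icc, mem_filter]
          omega
      _ = _ := by
          rw [sum_comm]
          refine sum_congr rfl fun t _ => ?_
          rw [← sum_filter, sum_const, nsmul_eq_mul]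
          ring
  have hH : (harmonic N : ℝ) = ∑ t ∈ Icc 1 N, (t : ℝ)⁻¹ := by
    rw [harmonic_eq_sum_Icc]; push_cast; rfl
  have hH0 : (0 : ℝ) ≤ harmonic N := by rw [hH]; positivity
  have hN : (Icc 1 N).Nonempty := by
    by_contra h
    rw [not_nonempty_iff_eq_empty] at h
    rw [h, sum_empty] at hS
    linarith
  have h1 : (harmonic N : ℝ) * ∑ x ∈ Z, G (f x) ≤
      ∑ t ∈ Icc 1 N, (harmonic N : ℝ) * (g t * (Z.filter fun x => t ≤ f x).card) * (t : ℝ)⁻¹ := by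
    refine (mul_le_mul_of_nonneg_left hS hH0).trans_eq ?_
    rw [mul_sum]
    exact sum_congr rfl fun t _ => by ring
  have h2 : ∑ t ∈ Icc 1 N,
      (harmonic N : ℝ) * (g t * (Z.filter fun x => t ≤ f x).card) * (t : ℝ)⁻¹ <
        ∑ t ∈ Icc 1 N, (∑ x ∈ Z, G (f x)) * (t : ℝ)⁻¹ := by
    refine sum_lt_sum_of_nonempty hN fun t ht => ?_
    have ht1 := (mem_Icc.1 ht).1
    have : (0 : ℝ) < t := by exact_mod_cast ht1
    exact mul_lt_mul_of_pos_right (hcon t ht1) (by positivity)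
  rw [← mul_sum, ← hH] at h2
  linarith

theorem exists_subset_addE_mul_mulE_le (X : Finset ℝ) (hX : (0 : ℝ) ∉ X) (hX0 : X.Nonempty) :
    ∃ A ⊆ X, A.Nonempty ∧ (addE A A : ℝ) * mulE X X ≤
      530 * (harmonic X.card : ℝ) ^ 3 * (X.card * √X.card) * (A.card : ℝ) ^ 4 := by
  set T := (X ×ˢ X).image fun p => p.1 * p.2 with hT
  have hTmem : ∀ a ∈ X, ∀ b ∈ X, a * b ∈ T := fun a ha b hb =>
    mem_image.2 ⟨(a, b), mem_product.2 ⟨ha, hb⟩, rfl⟩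
  have hT0 : (0 : ℝ) ∉ T := by
    intro h
    obtain ⟨⟨a, b⟩, hab, h0⟩ := mem_image.1 h
    rw [mem_product] at hab
    rcases mul_eq_zero.1 h0 with h | h
    · exact hX (h ▸ hab.1)
    · exact hX (h ▸ hab.2)
  have hrepN : ∀ s ∈ T, mulRep X X s ≤ X.card := fun s _ =>
    card_le_card_of_injOn Prod.fst (fun p hp => (mem_product.1 (mem_filter.1 hp).1).1) (by
      rintro ⟨a, b⟩ h ⟨a', b'⟩ h' heq
      simp only [coe_filter, mem_product, Set.mem_ofPred_eq] at h h' heq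
      subst heq
      have ha : a ≠ 0 := fun h0 => hX (h0 ▸ h.1.1)
      exact Prod.ext rfl (mul_left_cancel₀ ha (h.2.trans h'.2.symm)))
  have hE : (mulE X X : ℝ) = ∑ s ∈ T, (mulRep X X s : ℝ) ^ 2 := by
    rw [mulE_eq_sum_mulRep_sq X X T hTmem]
    push_cast
    rfl
  have hE0 : 0 < ∑ s ∈ T, (mulRep X X s : ℝ) ^ 2 := by
    obtain ⟨a, ha⟩ := hX0
    have : 0 < mulRep X X (a * a) :=
      card_pos.2 ⟨(a, a), mem_filter.2 ⟨mem_product.2 ⟨ha, ha⟩, rfl⟩⟩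
    exact sum_pos' (fun _ _ => sq_nonneg _) ⟨a * a, hTmem a ha a ha, by positivity⟩
  obtain ⟨D, hD, hED⟩ := exists_level_set_ge T (mulRep X X) X.card hrepN
    (fun t => 2 * (t : ℝ) ^ 2) (fun m => (m : ℝ) ^ 2) (fun m => by
      induction m with
      | zero => simp
      | succ m ih =>
        rw [sum_Icc_succ_top (by omega)]
        have : 2 * ((m + 1 : ℕ) : ℝ) ^ 2 / ((m + 1 : ℕ) : ℝ) = 2 * (m + 1) := by
          push_cast
          field_simp
        rw [this]
        push_cast
        nlinarith [Nat.cast_nonneg (α := ℝ) m]) hE0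
  rw [← hE] at hED hE0
  set P := T.filter fun s => D ≤ mulRep X X s with hPdef
  have hP0 : (0 : ℝ) ∉ P := fun h => hT0 (mem_filter.1 h).1
  set deg : ℝ → ℕ := fun a => (X.filter fun q => a * q ∈ P).card with hdeg
  have hdegP : D * P.card ≤ ∑ a ∈ X, deg a := by
    have h1 : ∑ a ∈ X, deg a = ((X ×ˢ X).filter fun p => p.1 * p.2 ∈ P).card := by
      simp only [hdeg, card_filter]
      rw [sum_product]
    have h2 : ((X ×ˢ X).filter fun p => p.1 * p.2 ∈ P).card = ∑ s ∈ P, mulRep X X s := by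
      rw [card_eq_sum_card_fiberwise (f := fun p : ℝ × ℝ => p.1 * p.2) (t := P)
        (fun p hp => by
          simp only [coe_filter, Set.mem_ofPred_eq] at hp
          exact hp.2)]
      refine sum_congr rfl fun s hs => ?_
      rw [mulRep, filter_filter]
      congr 1
      refine filter_congr fun p _ => ⟨fun h => h.2, fun h => ⟨h ▸ hs, h⟩⟩
    rw [h1, h2, mul_comm, ← smul_eq_mul]
    exact card_nsmul_le_sum _ _ _ fun s hs => (mem_filter.1 hs).2
  have hPpos : 0 < P.card := by
    rcases Nat.eq_zero_or_pos P.card with h | h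
    · rw [h] at hED
      simp only [CharP.cast_eq_zero, mul_zero] at hED
      linarith
    · exact h
  have hdegR : (D : ℝ) * P.card ≤ ∑ a ∈ X, (deg a : ℝ) := by exact_mod_cast hdegP
  have hDP : (0 : ℝ) < D * P.card := by
    have : 0 < D * P.card := Nat.mul_pos hD hPpos
    exact_mod_cast this
  obtain ⟨t, ht, hdegt⟩ := exists_level_set_ge X deg X.card (fun _ _ => card_filter_le _ _)
    (fun t => (t : ℝ)) (fun m => (m : ℝ)) (fun m => by
      have : ∀ t ∈ Icc 1 m, (t : ℝ) / t = 1 := fun t ht =>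
        div_self (by have := (mem_Icc.1 ht).1; positivity)
      rw [sum_congr rfl this]
      simp) (hDP.trans_le hdegR)
  set A := X.filter fun a => t ≤ deg a with hA
  have hlevel := hdegR.trans hdegt
  have hA0 : A.Nonempty := by
    rw [nonempty_iff_ne_empty]
    intro h
    rw [h] at hlevel
    simp only [card_empty, CharP.cast_eq_zero, mul_zero] at hlevel
    linarith
  refine ⟨A, filter_subset _ _, hA0, ?_⟩
  have hadd := addE_mul_sq_le X P A hX hP0 ht (fun a ha => (mem_filter.1 ha).2)
    (filter_subset _ _) hA0
  have htR : (0 : ℝ) < t := by exact_mod_cast ht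
  have hH : (0 : ℝ) ≤ harmonic X.card := by
    have := harmonic_pos (n := X.card) (card_pos.2 hX0).ne'
    exact_mod_cast this.le
  generalize (harmonic X.card : ℝ) = H at hED hlevel hH ⊢
  refine le_of_mul_le_mul_right ?_ (show (0 : ℝ) < t ^ 2 by positivity)
  calc (addE A A : ℝ) * mulE X X * t ^ 2 = addE A A * t ^ 2 * mulE X X := by ring
    _ ≤ 265 * (X.card * √X.card) * (A.card : ℝ) ^ 2 * P.card *
          (H * (2 * (D : ℝ) ^ 2 * P.card)) := by gcongr
    _ = 530 * H * (X.card * √X.card) * (A.card : ℝ) ^ 2 * ((D : ℝ) * P.card) ^ 2 := by ring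
    _ ≤ 530 * H * (X.card * √X.card) * (A.card : ℝ) ^ 2 * (H * (t * A.card)) ^ 2 := by gcongr
    _ = _ := by ring

theorem exists_decomposition (n : ℕ) {M : ℝ} (hM : 0 < M) (A : Finset ℝ) :
    (0 : ℝ) ∉ A → A.card ≤ n →
      ∃ B C : Finset ℝ, Disjoint B C ∧ A = B ∪ C ∧ (mulE C C : ℝ) ≤ M ∧
        (addE B B : ℝ) ≤
          (√(530 * (1 + Real.log n) ^ 3 * (n * √n) / M) * (B.card : ℝ) ^ 2) ^ 2 := by
  induction A using Finset.strongInduction with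
  | H A ih =>
    intro h0 hn
    rcases le_or_gt (mulE A A : ℝ) M with hE | hE
    · refine ⟨∅, A, disjoint_empty_left _, (empty_union _).symm, hE, ?_⟩
      simp [addE]
    · have hA0 : A.Nonempty := by
        rw [nonempty_iff_ne_empty]
        rintro rfl
        simp [mulE] at hE
        linarith
      obtain ⟨X, hXA, hX0, hX⟩ := exists_subset_addE_mul_mulE_le A h0 hA0
      obtain ⟨B, C, hBC, hu, hC, hB⟩ := ih (A \ X) (sdiff_ssubset hXA hX0)
        (fun h => h0 (mem_sdiff.1 h).1) ((card_le_card sdiff_subset).trans hn)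
      have hXB : Disjoint X B := disjoint_of_subset_right
        (subset_union_left.trans_eq hu.symm) disjoint_sdiff
      have hXC : Disjoint X C := disjoint_of_subset_right
        (subset_union_right.trans_eq hu.symm) disjoint_sdiff
      refine ⟨X ∪ B, C, disjoint_union_left.2 ⟨hXC, hBC⟩, ?_, hC, ?_⟩
      · rw [union_assoc, ← hu, union_sdiff_of_subset hXA]
      · rw [card_union_of_disjoint hXB]
        push_cast
        refine addE_union_le X B hXB (Real.sqrt_nonneg _) (by positivity) (by positivity) ?_ hB
        have hn1 : (1 : ℝ) ≤ A.card := by exact_mod_cast card_pos.2 hA0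
        have hnR : (A.card : ℝ) ≤ n := by exact_mod_cast hn
        have hlog : 0 ≤ Real.log n := Real.log_nonneg (hn1.trans hnR)
        have hH : (harmonic A.card : ℝ) ≤ 1 + Real.log n :=
          (harmonic_le_one_add_log _).trans
            (by gcongr)
        have hH0 : (0 : ℝ) ≤ harmonic A.card := by
          have := harmonic_pos (n := A.card) (card_pos.2 hA0).ne'
          exact_mod_cast this.le
        rw [mul_pow, Real.sq_sqrt (by positivity), div_mul_eq_mul_div, le_div_iff₀ hM]
        calc (addE X X : ℝ) * M ≤ addE X X * mulE A A := by gcongr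
          _ ≤ 530 * (harmonic A.card : ℝ) ^ 3 * (A.card * √A.card) * (X.card : ℝ) ^ 4 := hX
          _ ≤ 530 * (1 + Real.log n) ^ 3 * (n * √n) * (X.card : ℝ) ^ 4 := by gcongr
          _ = _ := by ring

theorem stmt16 :
    ∃ K c : ℝ, 0 < K ∧ 0 < c ∧
      ∀ A : Finset ℝ, (0:ℝ) ∉ A → 2 ≤ A.card →
        ∃ B C : Finset ℝ, Disjoint B C ∧ A = B ∪ C ∧
          max (addE B B : ℝ) (mulE C C : ℝ) ≤
            K * (A.card : ℝ) ^ ((3:ℝ) - 1/5) * (Real.log (A.card : ℝ)) ^ c := by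
  refine ⟨530 * 27, 3, by norm_num, by norm_num, fun A h0 hA => ?_⟩
  have hn2 : (2 : ℝ) ≤ A.card := by exact_mod_cast hA
  have hn0 : (0 : ℝ) < A.card := by linarith
  have hn1 : (1 : ℝ) ≤ A.card := by linarith
  obtain ⟨B, C, hBC, hu, hC, hB⟩ := exists_decomposition A.card
    (M := (A.card : ℝ) ^ ((3 : ℝ) - 1 / 5)) (by positivity) A h0 le_rfl
  refine ⟨B, C, hBC, hu, ?_⟩
  have hlog2 : 1 / 2 ≤ Real.log A.card :=
    (by linarith [Real.log_two_gt_d9] : (1 / 2 : ℝ) ≤ Real.log 2).trans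
      (Real.log_le_log (by norm_num) hn2)
  have hlog3 : Real.log A.card ^ (3 : ℝ) = Real.log A.card ^ 3 := by
    exact_mod_cast Real.rpow_natCast (Real.log A.card) 3
  have hlog8 : (1 / 2 : ℝ) ^ 3 ≤ Real.log A.card ^ 3 := by gcongr
  rw [hlog3]
  refine max_le ?_ ?_
  · have hcardB : (B.card : ℝ) ≤ A.card := by
      exact_mod_cast card_le_card (subset_union_left.trans_eq hu.symm)
    have hsqrt : √(A.card : ℝ) = (A.card : ℝ) ^ (1 / 2 : ℝ) := Real.sqrt_eq_rpow _
    have hpow : (A.card : ℝ) * √A.card * (A.card : ℝ) ^ 4 ≤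
        (A.card : ℝ) ^ ((3 : ℝ) - 1 / 5) * (A.card : ℝ) ^ ((3 : ℝ) - 1 / 5) := by
      calc (A.card : ℝ) * √A.card * (A.card : ℝ) ^ 4
          = (A.card : ℝ) ^ (5 : ℝ) * (A.card : ℝ) ^ (1 / 2 : ℝ) := by
            rw [hsqrt, show (5 : ℝ) = ((5 : ℕ) : ℝ) by norm_num, Real.rpow_natCast]
            ring
        _ = (A.card : ℝ) ^ ((5 : ℝ) + 1 / 2) := (Real.rpow_add hn0 _ _).symm
        _ ≤ (A.card : ℝ) ^ (((3 : ℝ) - 1 / 5) + (3 - 1 / 5)) :=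
            Real.rpow_le_rpow_of_exponent_le hn1 (by norm_num)
        _ = _ := Real.rpow_add hn0 _ _
    refine hB.trans ?_
    rw [mul_pow, Real.sq_sqrt (by positivity), div_mul_eq_mul_div,
      div_le_iff₀ (by positivity)]
    calc 530 * (1 + Real.log A.card) ^ 3 * (A.card * √A.card) * ((B.card : ℝ) ^ 2) ^ 2
        ≤ 530 * (3 * Real.log A.card) ^ 3 * (A.card * √A.card) * ((A.card : ℝ) ^ 2) ^ 2 := by
          gcongr
          linarith
      _ = 530 * 27 * Real.log A.card ^ 3 * (A.card * √A.card * (A.card : ℝ) ^ 4) := by ring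
      _ ≤ 530 * 27 * Real.log A.card ^ 3 *
          ((A.card : ℝ) ^ ((3 : ℝ) - 1 / 5) * (A.card : ℝ) ^ ((3 : ℝ) - 1 / 5)) := by gcongr
      _ = _ := by ring
  · refine hC.trans ?_
    have hM : (0 : ℝ) < (A.card : ℝ) ^ ((3 : ℝ) - 1 / 5) := by positivity
    nlinarith
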